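/- arXiv:0704.0208 — 2 statements merged into one kernel-verified Lean document; each statement's English description precedes it below -/
import Mathlib

section
/- Let g, h ∈ {1, −1}, let ε ∈ {1, −1}, and set A = ε·I₂. Let F and D be invertible 2×2 complex matrices and Φ a 6×6 complex matrix such that: g·A·F = F·A; F·D·A = D; and Φ·(I₂ ⊕ (I₂⊗F))·(K_h ⊕ (F⊗I₂)) = (G ⊕ (I₂⊗F))·Φ, where K_h = [[0,h],[h,0]] and G = [[1,0],[0,g]]. Then Φ is not invertible. (Hence in any solution of the pentagon equations with Φ invertible, the 2×2 associativity matrix A = a^x_{x,y,x} cannot be ±I₂.) -/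
open Matrix

noncomputable section

/-- Kronecker product of square matrices, with the standard (row-major) indexing. -/
def kron {m n : ℕ} (A : Matrix (Fin m) (Fin m) ℂ) (B : Matrix (Fin n) (Fin n) ℂ) :
    Matrix (Fin (m * n)) (Fin (m * n)) ℂ :=
  Matrix.of fun i j => A i.divNat j.divNat * B i.modNat j.modNat

/-- Block-diagonal sum of square matrices. -/
def bdiag {m n : ℕ} (A : Matrix (Fin m) (Fin m) ℂ) (B : Matrix (Fin n) (Fin n) ℂ) :
    Matrix (Fin (m + n)) (Fin (m + n)) ℂ :=
  Matrix.reindex finSumFinEquiv finSumFinEquiv (Matrix.fromBlocks A 0 0 B)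

theorem det_kron {m n : ℕ} (A : Matrix (Fin m) (Fin m) ℂ) (B : Matrix (Fin n) (Fin n) ℂ) :
    (kron A B).det = A.det ^ n * B.det ^ m := by
  have h : kron A B = Matrix.reindex finProdFinEquiv finProdFinEquiv (kroneckerMap (· * ·) A B) :=
    rfl
  rw [h, det_reindex_self, det_kronecker, Fintype.card_fin, Fintype.card_fin]

theorem det_bdiag {m n : ℕ} (A : Matrix (Fin m) (Fin m) ℂ) (B : Matrix (Fin n) (Fin n) ℂ) :
    (bdiag A B).det = A.det * B.det := by
  rw [bdiag, det_reindex_self, det_fromBlocks_zero₂₁]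

theorem det_mul_det_eq_of_intertwine {n : ℕ} {Φ M K N : Matrix (Fin n) (Fin n) ℂ}
    (hΦ : IsUnit Φ) (h : Φ * M * K = N * Φ) : M.det * K.det = N.det := by
  have hΦdet : Φ.det ≠ 0 := ((isUnit_iff_isUnit_det Φ).mp hΦ).ne_zero
  have e := congrArg det h
  rw [det_mul, det_mul, det_mul, mul_assoc, mul_comm N.det] at e
  exact mul_left_cancel₀ hΦdet e

/-- If `A = ±I₂` then the pentagon equations `g·A·F = F·A`, `F·D·A = D` and
`P^x_{y,x,x,x}` force `Φ` to be singular. -/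
theorem A_not_pm_identity
    (g h ε : ℂ) (hg : g = 1 ∨ g = -1) (hh : h = 1 ∨ h = -1) (hε : ε = 1 ∨ ε = -1)
    (F D : Matrix (Fin 2) (Fin 2) ℂ) (hF : IsUnit F) (hD : IsUnit D)
    (Φ : Matrix (Fin 6) (Fin 6) ℂ)
    (A : Matrix (Fin 2) (Fin 2) ℂ) (hA : A = ε • (1 : Matrix (Fin 2) (Fin 2) ℂ))
    (e1 : g • (A * F) = F * A)
    (e2 : F * D * A = D)
    (e3 : Φ * bdiag (1 : Matrix (Fin 2) (Fin 2) ℂ) (kron (1 : Matrix (Fin 2) (Fin 2) ℂ) F) *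
            bdiag !![(0 : ℂ), h; h, 0] (kron F (1 : Matrix (Fin 2) (Fin 2) ℂ)) =
          bdiag !![(1 : ℂ), 0; 0, g] (kron (1 : Matrix (Fin 2) (Fin 2) ℂ) F) * Φ) :
    ¬ IsUnit Φ := by
  have hε0 : ε ≠ 0 := by rcases hε with rfl | rfl <;> norm_num
  have hg1 : g = 1 := by
    have e : (g * ε) • F = ε • F := by simpa [hA, mul_smul] using e1
    exact (mul_eq_right₀ hε0).mp (smul_left_injective ℂ hF.ne_zero e)
  have hε2 : ε ^ 2 = 1 := by rcases hε with rfl | rfl <;> norm_num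
  have hh2 : h * h = 1 := mul_self_eq_one_iff.mpr hh
  have hFdet : F.det = 1 := by
    have hDdet : D.det ≠ 0 := ((isUnit_iff_isUnit_det D).mp hD).ne_zero
    have e := congrArg det e2
    rw [hA, det_mul, det_mul, det_smul, det_one, Fintype.card_fin, hε2, mul_one, mul_one] at e
    exact mul_right_cancel₀ hDdet (e.trans (one_mul _).symm)
  intro hΦ
  have e := det_mul_det_eq_of_intertwine (n := 2 + 2 * 2) hΦ e3
  rw [det_bdiag, det_bdiag, det_bdiag, det_kron, det_kron, det_fin_two_of, det_fin_two_of,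
    hFdet, hg1] at e
  norm_num [hh2] at e
end
end

section
/- With the explicit data below, the 16-dimensional pentagon equation holds: (D ⊕ E ⊕ (Φ⊗I₂))·τ₃·(I₂ ⊕ A ⊕ Φ̃)·τ₃·(D ⊕ E ⊕ (Φ⊗I₂))·τ₃ = τ₃·(I₂ ⊕ B ⊕ Φ̃)·τ₄·(I₂ ⊕ F ⊕ Φ̃). -/
open Matrix Complex

noncomputable section

def bC : ℂ := Complex.I
def phiC : ℂ := ((Real.sqrt 3 : ℂ) - 1) / 2
def dC : ℂ := (1 / (Real.sqrt 2 : ℂ)) * Complex.exp (7 * Real.pi * Complex.I / 12)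
def wC : ℂ := ((1 - (Real.sqrt 3 : ℂ)) / 4) * Complex.exp (2 * Real.pi * Complex.I / 3)
def yC : ℂ := (1 / 2) * (Complex.exp (-(Real.pi : ℂ) * Complex.I / 3) + Complex.I)
def zC : ℂ := (1 / 2) * Complex.exp (5 * Real.pi * Complex.I / 6)

def AM : Matrix (Fin 2) (Fin 2) ℂ := !![1, 0; 0, -1]
def SM : Matrix (Fin 2) (Fin 2) ℂ := !![0, 1; 1, 0]
def FM : Matrix (Fin 2) (Fin 2) ℂ := SM
def BM : Matrix (Fin 2) (Fin 2) ℂ := !![0, bC; bC⁻¹, 0]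
def DM : Matrix (Fin 2) (Fin 2) ℂ := dC • !![1, bC; 1, -bC]
def EM : Matrix (Fin 2) (Fin 2) ℂ := dC • !![bC, 1; -bC, 1]
def I2 : Matrix (Fin 2) (Fin 2) ℂ := 1
def I4 : Matrix (Fin 4) (Fin 4) ℂ := 1
def I8 : Matrix (Fin 8) (Fin 8) ℂ := 1

def PhiM : Matrix (Fin 6) (Fin 6) ℂ :=
  !![phiC, phiC, -(wC * bC), wC, wC, -(wC * bC);
     phiC, -phiC, -(wC * bC), wC, -wC, wC * bC;
     1, 1, -(yC * bC), zC, yC, -(zC * bC);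
     1, 1, -(zC * bC), yC, zC, -(yC * bC);
     1, -1, -(yC * bC), zC, -yC, zC * bC;
     -1, 1, zC * bC, -yC, zC, -(yC * bC)]

def PhiT : Matrix (Fin 12) (Fin 12) ℂ :=
  !![phiC,0,phiC,0,-(wC*bC),wC,wC,-(wC*bC),0,0,0,0;
     0,phiC,0,phiC,0,0,0,0,-(wC*bC),wC,wC,-(wC*bC);
     phiC,0,-phiC,0,-(wC*bC),wC,-wC,wC*bC,0,0,0,0;
     0,phiC,0,-phiC,0,0,0,0,-(wC*bC),wC,-wC,wC*bC;
     1,0,1,0,-(yC*bC),zC,yC,-(zC*bC),0,0,0,0;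
     1,0,1,0,-(zC*bC),yC,zC,-(yC*bC),0,0,0,0;
     1,0,-1,0,-(yC*bC),zC,-yC,zC*bC,0,0,0,0;
     -1,0,1,0,zC*bC,-yC,zC,-(yC*bC),0,0,0,0;
     0,1,0,1,0,0,0,0,-(yC*bC),zC,yC,-(zC*bC);
     0,1,0,1,0,0,0,0,-(zC*bC),yC,zC,-(yC*bC);
     0,1,0,-1,0,0,0,0,-(yC*bC),zC,-yC,zC*bC;
     0,-1,0,1,0,0,0,0,zC*bC,-yC,zC,-(yC*bC)]

/-- `Q`: the 4×4 permutation matrix exchanging the 2nd and 3rd standard basis vectors. -/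
def QM : Matrix (Fin 4) (Fin 4) ℂ := !![1,0,0,0; 0,0,1,0; 0,1,0,0; 0,0,0,1]

def tau3 : Matrix (Fin 16) (Fin 16) ℂ := bdiag (kron SM I4) I8
def tau4 : Matrix (Fin 16) (Fin 16) ℂ := bdiag (kron SM I4) (kron QM I2)

/-- The order `ℤ[√3, i]`, with computable arithmetic. -/
abbrev ZSqrtThreeI : Type := QuadraticAlgebra (QuadraticAlgebra ℤ 3 0) (-1) 0

namespace ZSqrtThreeI

theorem sqrt_three_sq : (Real.sqrt 3 : ℂ) ^ 2 = 3 := by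
  exact_mod_cast Real.sq_sqrt (show (0 : ℝ) ≤ 3 by norm_num)

/-- The embedding of `ℤ[√3, i]` into `ℂ`. -/
def toComplex : ZSqrtThreeI →+* ℂ where
  toFun u := (u.re.re + u.re.im * Real.sqrt 3) + (u.im.re + u.im.im * Real.sqrt 3) * Complex.I
  map_zero' := by simp
  map_one' := by simp [QuadraticAlgebra.re_one, QuadraticAlgebra.im_one]
  map_add' u v := by simp; ring
  map_mul' u v := by
    simp
    linear_combination
      (-(u.re.im * v.re.im : ℂ) - (u.re.im * v.im.im + u.im.im * v.re.im) * Complex.I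
        + u.im.im * v.im.im) * sqrt_three_sq
      - ((u.im.re + u.im.im * Real.sqrt 3) * (v.im.re + v.im.im * Real.sqrt 3) : ℂ)
        * Complex.I_sq

theorem toComplex_apply (u : ZSqrtThreeI) :
    toComplex u = (u.re.re + u.re.im * Real.sqrt 3)
      + (u.im.re + u.im.im * Real.sqrt 3) * Complex.I := rfl

def b : ZSqrtThreeI := ⟨⟨0, 0⟩, ⟨1, 0⟩⟩

/-- Eight times `φ`. -/
def phi : ZSqrtThreeI := ⟨⟨-4, 4⟩, ⟨0, 0⟩⟩

/-- Eight times `d`. -/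
def d : ZSqrtThreeI := ⟨⟨2, -2⟩, ⟨2, 2⟩⟩

/-- Eight times `w`. -/
def w : ZSqrtThreeI := ⟨⟨-1, 1⟩, ⟨-3, 1⟩⟩

/-- Eight times `y`. -/
def y : ZSqrtThreeI := ⟨⟨2, 0⟩, ⟨4, -2⟩⟩

/-- Eight times `z`. -/
def z : ZSqrtThreeI := ⟨⟨0, -2⟩, ⟨2, 0⟩⟩

theorem toComplex_eight : toComplex 8 = 8 := map_ofNat _ 8

theorem toComplex_b : toComplex b = bC := by
  simp [toComplex_apply, b, bC]

theorem toComplex_phi : toComplex phi = 8 * phiC := by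
  simp [toComplex_apply, phi, phiC]; ring

theorem exp_two_pi_div_three :
    Complex.exp (2 * Real.pi * Complex.I / 3) = -1 / 2 + Real.sqrt 3 / 2 * Complex.I := by
  have h : (2 * Real.pi * Complex.I / 3 : ℂ) =
      ((Real.pi - Real.pi / 3 : ℝ) : ℂ) * Complex.I := by push_cast; ring
  rw [h, Complex.exp_mul_I, ← Complex.ofReal_cos, ← Complex.ofReal_sin, Real.cos_pi_sub,
    Real.sin_pi_sub, Real.cos_pi_div_three, Real.sin_pi_div_three]
  push_cast; ring

theorem exp_neg_pi_div_three :
    Complex.exp (-(Real.pi : ℂ) * Complex.I / 3) = 1 / 2 - Real.sqrt 3 / 2 * Complex.I := by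
  have h : (-(Real.pi : ℂ) * Complex.I / 3 : ℂ) =
      ((-(Real.pi / 3) : ℝ) : ℂ) * Complex.I := by push_cast; ring
  rw [h, Complex.exp_mul_I, ← Complex.ofReal_cos, ← Complex.ofReal_sin, Real.cos_neg,
    Real.sin_neg, Real.cos_pi_div_three, Real.sin_pi_div_three]
  push_cast; ring

theorem exp_five_pi_div_six :
    Complex.exp (5 * Real.pi * Complex.I / 6) = -(Real.sqrt 3 / 2) + 1 / 2 * Complex.I := by
  have h : (5 * Real.pi * Complex.I / 6 : ℂ) =
      ((Real.pi - Real.pi / 6 : ℝ) : ℂ) * Complex.I := by push_cast; ring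
  rw [h, Complex.exp_mul_I, ← Complex.ofReal_cos, ← Complex.ofReal_sin, Real.cos_pi_sub,
    Real.sin_pi_sub, Real.cos_pi_div_six, Real.sin_pi_div_six]
  push_cast; ring

theorem exp_seven_pi_div_twelve :
    Complex.exp (7 * Real.pi * Complex.I / 12) =
      Real.sqrt 2 * ((1 - Real.sqrt 3) / 4 + (1 + Real.sqrt 3) / 4 * Complex.I) := by
  have h : (7 * Real.pi * Complex.I / 12 : ℂ) =
      ((Real.pi / 4 + Real.pi / 3 : ℝ) : ℂ) * Complex.I := by push_cast; ring
  rw [h, Complex.exp_mul_I, ← Complex.ofReal_cos, ← Complex.ofReal_sin, Real.cos_add,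
    Real.sin_add, Real.cos_pi_div_four, Real.sin_pi_div_four, Real.cos_pi_div_three,
    Real.sin_pi_div_three]
  push_cast; ring

theorem toComplex_d : toComplex d = 8 * dC := by
  have h : (Real.sqrt 2 : ℂ) ≠ 0 := by simp
  rw [dC, exp_seven_pi_div_twelve, ← mul_assoc (1 / _), one_div, inv_mul_cancel₀ h]
  simp [toComplex_apply, d]; ring

theorem toComplex_w : toComplex w = 8 * wC := by
  rw [wC, exp_two_pi_div_three]
  simp [toComplex_apply, w]
  linear_combination Complex.I * sqrt_three_sq

theorem toComplex_y : toComplex y = 8 * yC := by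
  rw [yC, exp_neg_pi_div_three]
  simp [toComplex_apply, y]; ring

theorem toComplex_z : toComplex z = 8 * zC := by
  rw [zC, exp_five_pi_div_six]
  simp [toComplex_apply, z]; ring

/-- Eight times the matrix `PhiM`, over `ℤ[√3, i]`. -/
def phiM : Matrix (Fin 6) (Fin 6) ZSqrtThreeI :=
  !![phi, phi, -(w * b), w, w, -(w * b);
     phi, -phi, -(w * b), w, -w, w * b;
     8, 8, -(y * b), z, y, -(z * b);
     8, 8, -(z * b), y, z, -(y * b);
     8, -8, -(y * b), z, -y, z * b;
     -8, 8, z * b, -y, z, -(y * b)]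

/-- Eight times the matrix `PhiT`, over `ℤ[√3, i]`. -/
def phiT : Matrix (Fin 12) (Fin 12) ZSqrtThreeI :=
  !![phi,0,phi,0,-(w*b),w,w,-(w*b),0,0,0,0;
     0,phi,0,phi,0,0,0,0,-(w*b),w,w,-(w*b);
     phi,0,-phi,0,-(w*b),w,-w,w*b,0,0,0,0;
     0,phi,0,-phi,0,0,0,0,-(w*b),w,-w,w*b;
     8,0,8,0,-(y*b),z,y,-(z*b),0,0,0,0;
     8,0,8,0,-(z*b),y,z,-(y*b),0,0,0,0;
     8,0,-8,0,-(y*b),z,-y,z*b,0,0,0,0;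
     -8,0,8,0,z*b,-y,z,-(y*b),0,0,0,0;
     0,8,0,8,0,0,0,0,-(y*b),z,y,-(z*b);
     0,8,0,8,0,0,0,0,-(z*b),y,z,-(y*b);
     0,8,0,-8,0,0,0,0,-(y*b),z,-y,z*b;
     0,-8,0,8,0,0,0,0,z*b,-y,z,-(y*b)]

/-- Kronecker product of square matrices over `ℤ[√3, i]`, with row-major indexing. -/
def kron {m n : ℕ} (A : Matrix (Fin m) (Fin m) ZSqrtThreeI)
    (B : Matrix (Fin n) (Fin n) ZSqrtThreeI) :
    Matrix (Fin (m * n)) (Fin (m * n)) ZSqrtThreeI :=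
  Matrix.of fun i j => A i.divNat j.divNat * B i.modNat j.modNat

/-- Block-diagonal sum of square matrices over `ℤ[√3, i]`. -/
def bdiag {m n : ℕ} (A : Matrix (Fin m) (Fin m) ZSqrtThreeI)
    (B : Matrix (Fin n) (Fin n) ZSqrtThreeI) :
    Matrix (Fin (m + n)) (Fin (m + n)) ZSqrtThreeI :=
  Matrix.reindex finSumFinEquiv finSumFinEquiv (Matrix.fromBlocks A 0 0 B)

theorem map_kron {m n : ℕ} (A : Matrix (Fin m) (Fin m) ZSqrtThreeI)
    (B : Matrix (Fin n) (Fin n) ZSqrtThreeI) :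
    (kron A B).map toComplex = _root_.kron (A.map toComplex) (B.map toComplex) := by
  ext i j
  simp [kron, _root_.kron]

theorem map_bdiag {m n : ℕ} (A : Matrix (Fin m) (Fin m) ZSqrtThreeI)
    (B : Matrix (Fin n) (Fin n) ZSqrtThreeI) :
    (bdiag A B).map toComplex = _root_.bdiag (A.map toComplex) (B.map toComplex) := by
  rw [bdiag, _root_.bdiag, Matrix.reindex_apply, Matrix.reindex_apply, ← Matrix.submatrix_map,
    Matrix.fromBlocks_map, Matrix.map_zero _ (map_zero _), Matrix.map_zero _ (map_zero _)]

/-- Eight times the matrix `D ⊕ E ⊕ (Φ ⊗ I₂)`, over `ℤ[√3, i]`. -/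
def outer : Matrix (Fin 16) (Fin 16) ZSqrtThreeI :=
  bdiag !![d, d * b; d, -(d * b)]
    (bdiag !![d * b, d; -(d * b), d] (kron phiM (1 : Matrix (Fin 2) (Fin 2) _)))

/-- The matrix `8 I₂ ⊕ C ⊕ 8 Φ̃` over `ℤ[√3, i]`. -/
def inner (C : Matrix (Fin 2) (Fin 2) ZSqrtThreeI) : Matrix (Fin 16) (Fin 16) ZSqrtThreeI :=
  bdiag !![8, 0; 0, 8] (bdiag C phiT)

/-- The permutation matrix `τ₃` over `ℤ[√3, i]`. -/
def tau3 : Matrix (Fin 16) (Fin 16) ZSqrtThreeI :=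
  bdiag (kron !![0, 1; 1, 0] (1 : Matrix (Fin 4) (Fin 4) _)) (1 : Matrix (Fin 8) (Fin 8) _)

/-- The permutation matrix `τ₄` over `ℤ[√3, i]`. -/
def tau4 : Matrix (Fin 16) (Fin 16) ZSqrtThreeI :=
  bdiag (kron !![0, 1; 1, 0] (1 : Matrix (Fin 4) (Fin 4) _))
    (kron !![1, 0, 0, 0; 0, 0, 1, 0; 0, 1, 0, 0; 0, 0, 0, 1] (1 : Matrix (Fin 2) (Fin 2) _))

/-- The permutation underlying `tau3`. -/
def perm3 : Equiv.Perm (Fin 16) :=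
  Function.Involutive.toPerm ![4, 5, 6, 7, 0, 1, 2, 3, 8, 9, 10, 11, 12, 13, 14, 15]
    (by unfold Function.Involutive; decide)

/-- The permutation underlying `tau4`. -/
def perm4 : Equiv.Perm (Fin 16) :=
  Function.Involutive.toPerm ![4, 5, 6, 7, 0, 1, 2, 3, 8, 9, 12, 13, 10, 11, 14, 15]
    (by unfold Function.Involutive; decide)

set_option maxRecDepth 10000 in
theorem tau3_eq : tau3 = (1 : Matrix _ _ ZSqrtThreeI).submatrix id perm3 := by decide +kernel

set_option maxRecDepth 10000 in
theorem tau4_eq : tau4 = (1 : Matrix _ _ ZSqrtThreeI).submatrix id perm4 := by decide +kernel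

set_option maxRecDepth 10000 in
theorem tau3_eq' : tau3 = (1 : Matrix _ _ ZSqrtThreeI).submatrix perm3 id := by decide +kernel

set_option maxRecDepth 100000 in
theorem pentagon_permuted :
    (outer * (inner !![8, 0; 0, -8]).submatrix perm3 perm3 * outer).submatrix id perm3 =
      (8 : ZSqrtThreeI) •
        ((inner !![0, 8 * b; -(8 * b), 0]).submatrix perm3 perm4 * inner !![0, 8; 8, 0]) := by
  decide +kernel

theorem mul_tau3 (M : Matrix (Fin 16) (Fin 16) ZSqrtThreeI) :
    M * tau3 = M.submatrix id perm3 := by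
  rw [tau3_eq]
  exact Matrix.mul_submatrix_one (Equiv.refl _) perm3 M

theorem mul_tau4 (M : Matrix (Fin 16) (Fin 16) ZSqrtThreeI) :
    M * tau4 = M.submatrix id perm4 := by
  rw [tau4_eq]
  exact Matrix.mul_submatrix_one (Equiv.refl _) perm4 M

theorem tau3_mul (M : Matrix (Fin 16) (Fin 16) ZSqrtThreeI) :
    tau3 * M = M.submatrix perm3 id := by
  rw [tau3_eq']
  exact Matrix.one_submatrix_mul perm3 (Equiv.refl _) M

theorem pentagon :
    outer * tau3 * inner !![8, 0; 0, -8] * tau3 * outer * tau3 =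
      (8 : ZSqrtThreeI) •
        (tau3 * inner !![0, 8 * b; -(8 * b), 0] * tau4 * inner !![0, 8; 8, 0]) := by
  rw [mul_assoc outer, mul_assoc outer, tau3_mul, mul_tau3, mul_tau3, mul_tau4, tau3_mul]
  simp only [Matrix.submatrix_submatrix, Function.comp_id, Function.id_comp]
  exact pentagon_permuted

theorem map_phiM : phiM.map toComplex = (8 : ℂ) • PhiM := by
  ext i j
  fin_cases i <;> fin_cases j <;>
    simp [phiM, PhiM, toComplex_b, toComplex_phi, toComplex_w, toComplex_y, toComplex_z,
      toComplex_eight, mul_assoc]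

theorem map_phiT : phiT.map toComplex = (8 : ℂ) • PhiT := by
  ext i j
  fin_cases i <;> fin_cases j <;>
    simp [phiT, PhiT, toComplex_b, toComplex_phi, toComplex_w, toComplex_y, toComplex_z,
      toComplex_eight, mul_assoc]

theorem bdiag_smul {m n : ℕ} (c : ℂ) (A : Matrix (Fin m) (Fin m) ℂ)
    (B : Matrix (Fin n) (Fin n) ℂ) :
    _root_.bdiag (c • A) (c • B) = c • _root_.bdiag A B := by
  have h := Matrix.fromBlocks_smul c A 0 0 B
  rw [smul_zero, smul_zero] at h
  rw [_root_.bdiag, ← h]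
  rfl

theorem kron_smul {m n : ℕ} (c : ℂ) (A : Matrix (Fin m) (Fin m) ℂ)
    (B : Matrix (Fin n) (Fin n) ℂ) :
    _root_.kron (c • A) B = c • _root_.kron A B := by
  ext i j
  simp [_root_.kron, mul_assoc]

theorem map_one {n : ℕ} :
    (1 : Matrix (Fin n) (Fin n) ZSqrtThreeI).map toComplex = 1 :=
  Matrix.map_one _ (_root_.map_zero _) (_root_.map_one _)

theorem map_outer : outer.map toComplex =
    (8 : ℂ) • _root_.bdiag DM (_root_.bdiag EM (_root_.kron PhiM I2)) := by
  have hD : (!![d, d * b; d, -(d * b)] : Matrix _ _ ZSqrtThreeI).map toComplex = (8 : ℂ) • DM := by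
    ext i j
    fin_cases i <;> fin_cases j <;> simp [DM, toComplex_b, toComplex_d, mul_assoc]
  have hE : (!![d * b, d; -(d * b), d] : Matrix _ _ ZSqrtThreeI).map toComplex = (8 : ℂ) • EM := by
    ext i j
    fin_cases i <;> fin_cases j <;> simp [EM, toComplex_b, toComplex_d, mul_assoc]
  rw [← bdiag_smul, ← bdiag_smul, ← kron_smul, ← hD, ← hE, ← map_phiM, I2, ← map_one,
    ← map_kron, ← map_bdiag, ← map_bdiag]
  rfl

theorem map_inner {C : Matrix (Fin 2) (Fin 2) ZSqrtThreeI} {M : Matrix (Fin 2) (Fin 2) ℂ}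
    (h : C.map toComplex = (8 : ℂ) • M) :
    (inner C).map toComplex = (8 : ℂ) • _root_.bdiag I2 (_root_.bdiag M PhiT) := by
  have h1 : (!![8, 0; 0, 8] : Matrix _ _ ZSqrtThreeI).map toComplex = (8 : ℂ) • I2 := by
    ext i j
    fin_cases i <;> fin_cases j <;> simp [I2, toComplex_eight]
  rw [← bdiag_smul, ← bdiag_smul, ← h, ← h1, ← map_phiT, ← map_bdiag, ← map_bdiag]
  rfl

theorem map_swap : (!![0, 1; 1, 0] : Matrix _ _ ZSqrtThreeI).map toComplex = SM := by
  ext i j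
  fin_cases i <;> fin_cases j <;> simp [SM]

theorem map_tau3 : tau3.map toComplex = _root_.tau3 := by
  rw [_root_.tau3, I4, I8, ← map_swap, ← map_one, ← map_one, ← map_kron, ← map_bdiag]
  rfl

theorem map_tau4 : tau4.map toComplex = _root_.tau4 := by
  have hQ : (!![1, 0, 0, 0; 0, 0, 1, 0; 0, 1, 0, 0; 0, 0, 0, 1] :
      Matrix _ _ ZSqrtThreeI).map toComplex = QM := by
    ext i j
    fin_cases i <;> fin_cases j <;> simp [QM]
  rw [_root_.tau4, I4, I2, ← map_swap, ← hQ, ← map_one, ← map_one, ← map_kron, ← map_kron,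
    ← map_bdiag]
  rfl

theorem map_innerA : (inner !![8, 0; 0, -8]).map toComplex =
    (8 : ℂ) • _root_.bdiag I2 (_root_.bdiag AM PhiT) :=
  map_inner (by ext i j; fin_cases i <;> fin_cases j <;> simp [AM, toComplex_eight])

theorem map_innerB : (inner !![0, 8 * b; -(8 * b), 0]).map toComplex =
    (8 : ℂ) • _root_.bdiag I2 (_root_.bdiag BM PhiT) :=
  map_inner (by ext i j; fin_cases i <;> fin_cases j <;> simp [BM, toComplex_eight, toComplex_b, bC])

theorem map_innerF : (inner !![0, 8; 8, 0]).map toComplex =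
    (8 : ℂ) • _root_.bdiag I2 (_root_.bdiag FM PhiT) :=
  map_inner (by ext i j; fin_cases i <;> fin_cases j <;> simp [FM, SM, toComplex_eight])

theorem map_smul (c : ZSqrtThreeI) (M : Matrix (Fin 16) (Fin 16) ZSqrtThreeI) :
    (c • M).map toComplex = toComplex c • M.map toComplex := by
  ext i j
  simp

end ZSqrtThreeI

/-- The explicit solution satisfies the sixteen-dimensional pentagon equation
`P^x_{x,x,x,x}`. -/
theorem sixteen_dim_pentagon_holds :
    bdiag DM (bdiag EM (kron PhiM I2)) * tau3 * bdiag I2 (bdiag AM PhiT) * tau3 *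
        bdiag DM (bdiag EM (kron PhiM I2)) * tau3 =
      tau3 * bdiag I2 (bdiag BM PhiT) * tau4 * bdiag I2 (bdiag FM PhiT) := by
  have h := congrArg (fun M => M.map ZSqrtThreeI.toComplex) ZSqrtThreeI.pentagon
  simp only [Matrix.map_mul, ZSqrtThreeI.map_smul, ZSqrtThreeI.map_outer, ZSqrtThreeI.map_tau3,
    ZSqrtThreeI.map_tau4, ZSqrtThreeI.map_innerA, ZSqrtThreeI.map_innerB,
    ZSqrtThreeI.map_innerF, ZSqrtThreeI.toComplex_eight, Matrix.smul_mul, Matrix.mul_smul] at h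
  exact smul_right_injective _ (by norm_num : (8 : ℂ) ≠ 0)
    (smul_right_injective _ (by norm_num : (8 : ℂ) ≠ 0)
      (smul_right_injective _ (by norm_num : (8 : ℂ) ≠ 0) h))
end
end
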